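/- Let G be a group and S a finite subset of G with k ≥ 3 elements such that 1 ∉ S and S⁻¹ = S. For n ∈ ℕ let B_n := ⋃_{m ≤ n} S^m be the set of products of at most n elements of S (with B_0 = {1}). Then for all natural numbers ℓ, n with ℓ < n, (k − 2) · |B_n| ≤ ((k − 1)^{ℓ+1} − 1) · |B_{n−ℓ}|. -/

import Mathlib

open scoped Pointwise

/-- `B_n := ⋃_{m ≤ n} S^m`, the ball of radius `n` for the generating set `S`
(`B_0 = {1}`). -/
def ballOf {G : Type*} [Group G] [DecidableEq G] (S : Finset G) (n : ℕ) : Finset G :=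
  (Finset.range (n + 1)).biUnion fun m => S ^ m

section Ball

variable {G : Type*} [Group G] [DecidableEq G]

theorem mem_ballOf {S : Finset G} {n : ℕ} {x : G} :
    x ∈ ballOf S n ↔ ∃ m ≤ n, x ∈ S ^ m := by
  simp [ballOf]

theorem ballOf_subset_succ (S : Finset G) (n : ℕ) : ballOf S n ⊆ ballOf S (n + 1) := fun x hx => by
  obtain ⟨m, hm, hx⟩ := mem_ballOf.1 hx
  exact mem_ballOf.2 ⟨m, by omega, hx⟩

/-- Every element of the sphere of radius `n + 1` is a product of an element of the sphere of
radius `n` and a generator. -/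
theorem exists_mul_of_mem_ballOf_sdiff {S : Finset G} {n : ℕ} {x : G}
    (hx : x ∈ ballOf S (n + 1) \ ballOf S n) :
    ∃ y ∈ S ^ n, (∀ m < n, y ∉ S ^ m) ∧ ∃ s ∈ S, y * s = x := by
  obtain ⟨hx, hxn⟩ := Finset.mem_sdiff.1 hx
  obtain ⟨m, hm, hxm⟩ := mem_ballOf.1 hx
  obtain rfl : m = n + 1 := by
    by_contra h
    exact hxn (mem_ballOf.2 ⟨m, by omega, hxm⟩)
  rw [pow_succ] at hxm
  obtain ⟨y, hy, s, hs, rfl⟩ := Finset.mem_mul.1 hxm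
  refine ⟨y, hy, fun m hm hym => hxn (mem_ballOf.2 ⟨m + 1, by omega, ?_⟩), s, hs, rfl⟩
  rw [pow_succ]
  exact Finset.mul_mem_mul hym hs

theorem card_sphere_succ_le {S : Finset G} (hsymm : S⁻¹ = S) (n : ℕ) :
    (ballOf S (n + 2) \ ballOf S (n + 1)).card ≤
      (S.card - 1) * (ballOf S (n + 1) \ ballOf S n).card := by
  have key : ∀ y ∈ ballOf S (n + 1) \ ballOf S n, ∃ t ∈ S, y * t ∈ ballOf S n := by
    intro y hy
    obtain ⟨z, hz, -, s, hs, rfl⟩ := exists_mul_of_mem_ballOf_sdiff hy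
    refine ⟨s⁻¹, hsymm ▸ Finset.inv_mem_inv hs, mem_ballOf.2 ⟨n, le_rfl, ?_⟩⟩
    simpa using hz
  choose! t ht hyt using key
  have hsub : ballOf S (n + 2) \ ballOf S (n + 1) ⊆
      (ballOf S (n + 1) \ ballOf S n).biUnion fun y => (S.erase (t y)).image (y * ·) := by
    intro x hx
    obtain ⟨y, hy, hy', s, hs, rfl⟩ := exists_mul_of_mem_ballOf_sdiff hx
    have hyn : y ∈ ballOf S (n + 1) \ ballOf S n := by
      refine Finset.mem_sdiff.2 ⟨mem_ballOf.2 ⟨n + 1, le_rfl, hy⟩, fun h => ?_⟩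
      obtain ⟨m, hm, hym⟩ := mem_ballOf.1 h
      exact hy' m (by omega) hym
    refine Finset.mem_biUnion.2 ⟨y, hyn, Finset.mem_image.2 ⟨s, Finset.mem_erase.2 ⟨?_, hs⟩, rfl⟩⟩
    rintro rfl
    exact (Finset.mem_sdiff.1 hx).2 (ballOf_subset_succ S n (hyt y hyn))
  refine (Finset.card_le_card hsub).trans ?_
  rw [mul_comm]
  refine Finset.card_biUnion_le_card_mul _ _ _ fun y hy => Finset.card_image_le.trans ?_
  rw [Finset.card_erase_of_mem (ht y hy)]

theorem card_sphere_add_le {S : Finset G} (hsymm : S⁻¹ = S) (m i : ℕ) :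
    (ballOf S (m + 1 + i) \ ballOf S (m + i)).card ≤
      (S.card - 1) ^ i * (ballOf S (m + 1)).card := by
  induction i with
  | zero => simpa using Finset.card_le_card Finset.sdiff_subset
  | succ i ih =>
    have h := card_sphere_succ_le hsymm (m + i)
    rw [show m + i + 2 = m + 1 + (i + 1) by ring, show m + i + 1 = m + 1 + i by ring] at h
    rw [show m + (i + 1) = m + 1 + i by ring, pow_succ', mul_assoc]
    exact h.trans (Nat.mul_le_mul_left _ ih)

theorem card_ballOf_add_le {S : Finset G} (hsymm : S⁻¹ = S) (m l : ℕ) :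
    (ballOf S (m + 1 + l)).card ≤
      (∑ i ∈ Finset.range (l + 1), (S.card - 1) ^ i) * (ballOf S (m + 1)).card := by
  induction l with
  | zero => simp
  | succ l ih =>
    rw [Finset.sum_range_succ, add_mul]
    have h := card_sphere_add_le hsymm m (l + 1)
    rw [show m + (l + 1) = m + 1 + l by ring] at h
    have h' := Finset.card_sdiff_add_card_eq_card (ballOf_subset_succ S (m + 1 + l))
    rw [show m + 1 + l + 1 = m + 1 + (l + 1) by ring] at h'
    omega

end Ball

/-- if `S` is a finite symmetric set of `k ≥ 3` elements with `1 ∉ S`,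
then for `ℓ < n`, `(k−2)·|B_n| ≤ ((k−1)^{ℓ+1} − 1)·|B_{n−ℓ}|`. -/
theorem card_ball_le_of_ball_sub {G : Type*} [Group G] [DecidableEq G]
    (S : Finset G) (k : ℕ) (hcard : S.card = k) (hk : 3 ≤ k)
    (hone : (1 : G) ∉ S) (hsymm : S⁻¹ = S) (ℓ n : ℕ) (hℓn : ℓ < n) :
    (k - 2) * (ballOf S n).card ≤
      ((k - 1) ^ (ℓ + 1) - 1) * (ballOf S (n - ℓ)).card := by
  obtain ⟨m, rfl⟩ : ∃ m, n = m + 1 + ℓ := ⟨n - ℓ - 1, by omega⟩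
  have h := card_ballOf_add_le hsymm m ℓ
  rw [hcard] at h
  have hgeom := geom_sum_mul_of_one_le (show 1 ≤ k - 1 by omega) (ℓ + 1)
  rw [show k - 1 - 1 = k - 2 by omega] at hgeom
  rw [Nat.add_sub_cancel, ← hgeom, mul_comm _ (k - 2), mul_assoc]
  exact Nat.mul_le_mul_left _ h
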